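/- Equivalence with the disturbance-feedback parameterization: the matrix I − ZÂ is invertible, and for any x0 ∈ ℝⁿ and any Φu ∈ ℝ^{(T+1)p×n}, a vector x ∈ ℝ^{(T+1)n} satisfies the affine constraint (I − ZÂ)x = ZB̂Φu x0 + E1 x0 if and only if x = Φx x0, where Φx := (I − ZÂ)⁻¹(ZB̂Φu + E1) is the unique matrix satisfying (I − ZÂ)Φx − ZB̂Φu = E1. -/

import Mathlib

open Matrix

/-- `Â = blkdiag(A, …, A, 0)`: block diagonal with `T` copies of `A` followed by a zero block. -/
noncomputable def Ahat {n : ℕ} (T : ℕ) (A : Matrix (Fin n) (Fin n) ℝ) :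
    Matrix (Fin (T + 1) × Fin n) (Fin (T + 1) × Fin n) ℝ :=
  fun si tj => if si.1 = tj.1 ∧ (si.1 : ℕ) < T then A si.2 tj.2 else 0

/-- `B̂ = blkdiag(B, …, B, 0)`: block diagonal with `T` copies of `B` followed by a zero block. -/
noncomputable def Bhat {n p : ℕ} (T : ℕ) (B : Matrix (Fin n) (Fin p) ℝ) :
    Matrix (Fin (T + 1) × Fin n) (Fin (T + 1) × Fin p) ℝ :=
  fun si tj => if si.1 = tj.1 ∧ (si.1 : ℕ) < T then B si.2 tj.2 else 0

/-- The block-downshift matrix `Z`: identity blocks on the first block subdiagonal. -/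
noncomputable def Zshift (T n : ℕ) :
    Matrix (Fin (T + 1) × Fin n) (Fin (T + 1) × Fin n) ℝ :=
  fun si tj => if (si.1 : ℕ) = (tj.1 : ℕ) + 1 ∧ si.2 = tj.2 then 1 else 0

/-- A block matrix (blocks indexed by times `0, …, T`) is block lower triangular if its
`(s, t)` block vanishes whenever `s < t`. -/
def BlockLowerTri {T a b : ℕ} (M : Matrix (Fin (T + 1) × Fin a) (Fin (T + 1) × Fin b) ℝ) :
    Prop :=
  ∀ (s t : Fin (T + 1)) (i : Fin a) (j : Fin b), (s : ℕ) < (t : ℕ) → M (s, i) (t, j) = 0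

/-- A block matrix is strictly block lower triangular if its `(s, t)` block vanishes
whenever `s ≤ t`. -/
def StrictBlockLowerTri {T a b : ℕ}
    (M : Matrix (Fin (T + 1) × Fin a) (Fin (T + 1) × Fin b) ℝ) : Prop :=
  ∀ (s t : Fin (T + 1)) (i : Fin a) (j : Fin b), (s : ℕ) ≤ (t : ℕ) → M (s, i) (t, j) = 0

/-- `E1`: block-column matrix whose first `n × n` block is the identity, remaining blocks 0. -/
noncomputable def E1mat (T n : ℕ) : Matrix (Fin (T + 1) × Fin n) (Fin n) ℝ :=
  fun ti j => if (ti.1 : ℕ) = 0 ∧ ti.2 = j then 1 else 0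

theorem blockLowerTri_Ahat {n : ℕ} (T : ℕ) (A : Matrix (Fin n) (Fin n) ℝ) :
    BlockLowerTri (Ahat T A) := by
  intro s t i j hst
  have hne : s ≠ t := fun h => by simp [h] at hst
  simp [Ahat, hne]

theorem BlockLowerTri.strictBlockLowerTri_Zshift_mul {T n b : ℕ}
    {M : Matrix (Fin (T + 1) × Fin n) (Fin (T + 1) × Fin b) ℝ} (hM : BlockLowerTri M) :
    StrictBlockLowerTri (Zshift T n * M) := by
  intro s t i j hst
  rw [Matrix.mul_apply]
  refine Finset.sum_eq_zero fun k _ => ?_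
  by_cases hk : (s : ℕ) = (k.1 : ℕ) + 1
  · rw [hM k.1 t k.2 j (by omega), mul_zero]
  · simp [Zshift, hk]

theorem StrictBlockLowerTri.isUnit_one_sub {T n : ℕ}
    {N : Matrix (Fin (T + 1) × Fin n) (Fin (T + 1) × Fin n) ℝ} (hN : StrictBlockLowerTri N) :
    IsUnit (1 - N) := by
  rw [← Matrix.mulVec_injective_iff_isUnit]
  refine (injective_iff_map_eq_zero (Matrix.mulVecLin (1 - N))).2 fun x hx => ?_
  have hfix : x = N.mulVec x := by
    rwa [Matrix.mulVecLin_apply, Matrix.sub_mulVec, Matrix.one_mulVec, sub_eq_zero] at hx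
  have hzero : ∀ (m : ℕ) (s : Fin (T + 1)) (i : Fin n), (s : ℕ) = m → x (s, i) = 0 := by
    intro m
    induction m using Nat.strong_induction_on with
    | _ m ih =>
      intro s i hs
      rw [hfix]
      refine Finset.sum_eq_zero fun k _ => ?_
      by_cases hk : (k.1 : ℕ) < m
      · rw [ih k.1 hk k.1 k.2 rfl, mul_zero]
      · exact mul_eq_zero_of_left (hN s k.1 i k.2 (by omega)) _
  exact funext fun k => hzero k.1 k.1 k.2 rfl

/-- equivalence with the disturbance-feedback parameterization. `I - ZÂ` is
invertible, and for any `x0` and `Φu`, a vector `x` satisfies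
`(I - ZÂ) x = ZB̂ Φu x0 + E1 x0` if and only if `x = Φx x0`, where
`Φx := (I - ZÂ)⁻¹ (ZB̂ Φu + E1)` is the unique matrix satisfying
`(I - ZÂ) Φx - ZB̂ Φu = E1`. -/
theorem sls_disturbance_feedback_equiv {n p T : ℕ}
    (A : Matrix (Fin n) (Fin n) ℝ) (B : Matrix (Fin n) (Fin p) ℝ)
    (x0 : Fin n → ℝ)
    (Phiu : Matrix (Fin (T + 1) × Fin p) (Fin n) ℝ) :
    IsUnit (1 - Zshift T n * Ahat T A) ∧
    ((1 - Zshift T n * Ahat T A) *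
        ((1 - Zshift T n * Ahat T A)⁻¹ * (Zshift T n * Bhat T B * Phiu + E1mat T n)) -
      Zshift T n * Bhat T B * Phiu = E1mat T n) ∧
    (∀ Psi : Matrix (Fin (T + 1) × Fin n) (Fin n) ℝ,
      (1 - Zshift T n * Ahat T A) * Psi - Zshift T n * Bhat T B * Phiu = E1mat T n →
      Psi = (1 - Zshift T n * Ahat T A)⁻¹ * (Zshift T n * Bhat T B * Phiu + E1mat T n)) ∧
    (∀ x : Fin (T + 1) × Fin n → ℝ,
      (1 - Zshift T n * Ahat T A).mulVec x =
          (Zshift T n * Bhat T B * Phiu).mulVec x0 + (E1mat T n).mulVec x0 ↔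
        x = ((1 - Zshift T n * Ahat T A)⁻¹ *
          (Zshift T n * Bhat T B * Phiu + E1mat T n)).mulVec x0) := by
  have hU : IsUnit (1 - Zshift T n * Ahat T A) :=
    (blockLowerTri_Ahat T A).strictBlockLowerTri_Zshift_mul.isUnit_one_sub
  have hdet := (Matrix.isUnit_iff_isUnit_det _).1 hU
  refine ⟨hU, ?_, fun Psi hPsi => ?_, fun x => ?_⟩
  · rw [Matrix.mul_nonsing_inv_cancel_left _ _ hdet, add_sub_cancel_left]
  · rw [← sub_eq_iff_eq_add'.1 hPsi, Matrix.nonsing_inv_mul_cancel_left _ _ hdet]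
  · rw [← Matrix.add_mulVec, ← Matrix.mulVec_mulVec]
    constructor
    · intro h
      rw [← h, Matrix.mulVec_mulVec, Matrix.nonsing_inv_mul _ hdet, Matrix.one_mulVec]
    · intro h
      rw [h, Matrix.mulVec_mulVec, Matrix.mul_nonsing_inv _ hdet, Matrix.one_mulVec]
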